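/- Let O be a point of ℝ². The map sending a closed polygonal line l not passing through O to its winding number w(l, O) induces a bijection between the set of homotopy classes in ℝ² ∖ {O} of closed polygonal lines not passing through O and the set ℤ of integers: two such closed polygonal lines are homotopic in ℝ² ∖ {O} if and only if they have equal winding numbers around O, and every integer is the winding number around O of some closed polygonal line not passing through O. -/

import Mathlib

open Real

/-- Equality of lists up to cyclic rotation. -/
def CycEq {α : Type*} (l₁ l₂ : List α) : Prop := ∃ n : ℕ, l₂ = l₁.rotate n

/-- Elementary cancellation in `N`: removal of a vertex `B` whose cyclically adjacent
vertices `A`, `C` satisfy `convexHull {A, B, C} ⊆ N`. -/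
def ElemCancel (N : Set ℂ) (l l' : List ℂ) : Prop :=
  ∃ (B : ℂ) (rest : List ℂ), rest ≠ [] ∧ CycEq l (B :: rest) ∧ CycEq l' rest ∧
    convexHull ℝ {rest.getLastD B, B, rest.headD B} ⊆ N

/-- Homotopy in `N`: the equivalence relation generated by cyclic rotation and
elementary cancellations in `N`. -/
def Homotopic (N : Set ℂ) : List ℂ → List ℂ → Prop :=
  Relation.EqvGen (fun l l' => CycEq l l' ∨ ElemCancel N l l')


/-- The cyclically next vertex after position `i`. -/
def cnext (l : List ℂ) (i : Fin l.length) : ℂ :=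
  l.get ⟨(i.1 + 1) % l.length, Nat.mod_lt _ (Nat.lt_of_le_of_lt (Nat.zero_le _) i.isLt)⟩

/-- The total angle `∑ᵢ ∠AᵢOAᵢ₊₁` (equal to `2π · w(l, O)`). -/
noncomputable def windingSum (O : ℂ) (l : List ℂ) : ℝ :=
  ∑ i : Fin l.length, Complex.arg ((cnext l i - O) / (l.get i - O))

/-- The closed polygonal line `l` does not pass through the point `O`. -/
def NotThrough (O : ℂ) (l : List ℂ) : Prop :=
  ∀ i : Fin l.length, O ∉ segment ℝ (l.get i) (cnext l i)


/-- Path from `a` to `b` through the interior vertices. -/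
def Ch (r : ℂ → ℂ → Prop) : ℂ → List ℂ → ℂ → Prop
  | a, [], b => r a b
  | a, x :: L, b => r a x ∧ Ch r x L b

/-- Sum along a path. -/
def ps (g : ℂ → ℂ → ℝ) : ℂ → List ℂ → ℂ → ℝ
  | a, [], b => g a b
  | a, x :: L, b => g a x + ps g x L b

theorem Ch_append (r : ℂ → ℂ → Prop) (a : ℂ) (L : List ℂ) (x : ℂ) (M : List ℂ) (b : ℂ) :
    Ch r a (L ++ x :: M) b ↔ Ch r a L x ∧ Ch r x M b := by
  induction L generalizing a with
  | nil => simp [Ch]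
  | cons y L ih => simp [Ch, ih, and_assoc]

theorem ps_append (g : ℂ → ℂ → ℝ) (a : ℂ) (L : List ℂ) (x : ℂ) (M : List ℂ) (b : ℂ) :
    ps g a (L ++ x :: M) b = ps g a L x + ps g x M b := by
  induction L generalizing a with
  | nil => simp [ps]
  | cons y L ih => simp [ps, ih, add_assoc]

theorem Ch_reverse (r : ℂ → ℂ → Prop) (hr : ∀ a b, r a b → r b a) (a : ℂ) (L : List ℂ) (b : ℂ)
    (h : Ch r a L b) : Ch r b L.reverse a := by
  induction L generalizing a with
  | nil => exact hr _ _ h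
  | cons y L ih =>
    rw [List.reverse_cons, Ch_append]
    exact ⟨ih _ h.2, hr _ _ h.1⟩

theorem Ch_map (r : ℂ → ℂ → Prop) (T : ℂ → ℂ) (hr : ∀ a b, r a b → r (T a) (T b))
    (a : ℂ) (L : List ℂ) (b : ℂ)
    (h : Ch r a L b) : Ch r (T a) (L.map T) (T b) := by
  induction L generalizing a with
  | nil => exact hr _ _ h
  | cons y L ih => exact ⟨hr _ _ h.1, ih _ h.2⟩

theorem cnext_cons (A : ℂ) (t : List ℂ) (i : Fin (A :: t).length) :
    cnext (A :: t) i = (t ++ [A])[i.1]'(by simpa using i.2) := by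
  obtain ⟨i, hi⟩ := i
  unfold cnext
  simp only [List.get_eq_getElem, List.length_cons] at hi ⊢
  rcases Nat.lt_or_ge i t.length with h | h
  · have : (i + 1) % (t.length + 1) = i + 1 := Nat.mod_eq_of_lt (by omega)
    simp [this, List.getElem_append_left h]
  · have : i = t.length := by omega
    subst this
    simp

theorem sum_ps (g : ℂ → ℂ → ℝ) (a : ℂ) (t : List ℂ) (b : ℂ) :
    ∑ i : Fin (t.length + 1), g ((a :: t)[i.1]'(by simpa using i.2))
      ((t ++ [b])[i.1]'(by simpa using i.2)) = ps g a t b := by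
  induction t generalizing a with
  | nil => simp [ps]
  | cons x t ih =>
    rw [ps, ← ih x, Fin.sum_univ_succ]
    rfl

theorem forall_Ch (r : ℂ → ℂ → Prop) (a : ℂ) (t : List ℂ) (b : ℂ) :
    (∀ i : Fin (t.length + 1), r ((a :: t)[i.1]'(by simpa using i.2))
      ((t ++ [b])[i.1]'(by simpa using i.2))) ↔ Ch r a t b := by
  induction t generalizing a with
  | nil => simp [Ch]
  | cons x t ih =>
    rw [Ch, ← ih x]
    exact Fin.forall_fin_succ

noncomputable def ang (O a b : ℂ) : ℝ := Complex.arg ((b - O) / (a - O))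

def good (O a b : ℂ) : Prop := O ∉ segment ℝ a b

theorem windingSum_cons (O A : ℂ) (t : List ℂ) :
    windingSum O (A :: t) = ps (ang O) A t A := by
  rw [← sum_ps]
  unfold windingSum
  simp only [cnext_cons]
  rfl

theorem notThrough_cons (O A : ℂ) (t : List ℂ) :
    NotThrough O (A :: t) ↔ Ch (good O) A t A := by
  rw [← forall_Ch]
  unfold NotThrough
  simp only [cnext_cons]
  rfl

theorem getLastD_aux (c : ℂ) (v : List ℂ) (a b : ℂ) : (c :: (v ++ [a])).getLastD b = a := by
  rw [← List.cons_append, List.getLastD_eq_getLast?, List.getLast?_append]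
  simp

theorem arg_div_of_re_pos {a b : ℂ} (ha : 0 < a.re) (hb : 0 < b.re) :
    (b / a).arg = b.arg - a.arg := by
  have ha0 : a ≠ 0 := by rintro rfl; simp at ha
  have hb0 : b ≠ 0 := by rintro rfl; simp at hb
  have h1 := abs_lt.1 (Complex.abs_arg_lt_pi_div_two_iff.2 (Or.inl ha))
  have h2 := abs_lt.1 (Complex.abs_arg_lt_pi_div_two_iff.2 (Or.inl hb))
  have e : b / a = Complex.exp (Complex.log b - Complex.log a) := by
    rw [Complex.exp_sub, Complex.exp_log ha0, Complex.exp_log hb0]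
  have := Complex.log_exp (x := Complex.log b - Complex.log a)
    (by simp only [Complex.sub_im, Complex.log_im]; linarith)
    (by simp only [Complex.sub_im, Complex.log_im]; linarith)
  rw [← Complex.log_im, e, this]
  simp [Complex.log_im]

theorem tri_ang (O A B C : ℂ) (h : convexHull ℝ {A, B, C} ⊆ ({O}ᶜ : Set ℂ)) :
    ang O A B + ang O B C = ang O A C := by
  have hO : O ∉ convexHull ℝ ({A, B, C} : Set ℂ) := fun hh => h hh rfl
  have hcl : IsClosed (convexHull ℝ ({A, B, C} : Set ℂ)) :=
    (Set.Finite.isCompact_convexHull (𝕜 := ℝ) (by simp)).isClosed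
  obtain ⟨f, u, h1, h2⟩ := geometric_hahn_banach_point_closed (convex_convexHull ℝ _) hcl hO
  set c : ℂ := ⟨f 1, - f Complex.I⟩ with hc
  have key : ∀ z : ℂ, (z * c).re = f z := by
    intro z
    have : z = z.re • (1 : ℂ) + z.im • Complex.I := by simp
    conv_rhs => rw [this, map_add, map_smul, map_smul]
    simp [hc, Complex.mul_re]
  have pos : ∀ z ∈ ({A, B, C} : Set ℂ), 0 < ((z - O) * c).re := by
    intro z hz
    rw [key, map_sub]
    have := h2 z (subset_convexHull ℝ _ hz)
    linarith
  have pA := pos A (by simp)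
  have pB := pos B (by simp)
  have pC := pos C (by simp)
  have hc0 : c ≠ 0 := by intro h0; rw [h0] at pA; simp at pA
  have e : ∀ x y : ℂ, ang O x y = (((y - O) * c) / ((x - O) * c)).arg := by
    intro x y; rw [ang, mul_div_mul_right _ _ hc0]
  rw [e, e, e, arg_div_of_re_pos pA pB, arg_div_of_re_pos pB pC, arg_div_of_re_pos pA pC]
  ring

theorem tri_good (O : ℂ) (s : Set ℂ) (h : convexHull ℝ s ⊆ ({O}ᶜ : Set ℂ)) {x y : ℂ}
    (hx : x ∈ s) (hy : y ∈ s) : good O x y := fun hh =>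
  h (segment_subset_convexHull hx hy hh) rfl

def WInv (O : ℂ) (l l' : List ℂ) : Prop :=
  (NotThrough O l ↔ NotThrough O l') ∧ (windingSum O l = windingSum O l' ∨ ¬ NotThrough O l)

theorem WInv.refl (O : ℂ) (l : List ℂ) : WInv O l l := ⟨Iff.rfl, Or.inl rfl⟩

theorem WInv.symm {O : ℂ} {l l' : List ℂ} (h : WInv O l l') : WInv O l' l :=
  ⟨h.1.symm, by rw [← h.1]; exact h.2.imp Eq.symm id⟩

theorem WInv.trans {O : ℂ} {l l' l'' : List ℂ} (h : WInv O l l') (h' : WInv O l' l'') :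
    WInv O l l'' := by
  refine ⟨h.1.trans h'.1, ?_⟩
  rcases h.2 with h1 | h1
  · rcases h'.2 with h2 | h2
    · exact Or.inl (h1.trans h2)
    · exact Or.inr (fun hh => h2 (h.1.1 hh))
  · exact Or.inr h1

theorem inv_rotate (O : ℂ) (l : List ℂ) (n : ℕ) : WInv O l (l.rotate n) := by
  induction n generalizing l with
  | zero => simpa using WInv.refl O l
  | succ n ih =>
    cases l with
    | nil => simpa using WInv.refl O []
    | cons A t =>
      rw [List.rotate_cons_succ]
      refine WInv.trans ?_ (ih _)
      cases t with
      | nil => exact WInv.refl O _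
      | cons B t =>
        rw [WInv, List.cons_append, notThrough_cons, notThrough_cons, windingSum_cons,
          windingSum_cons, Ch_append, ps_append]
        simp only [Ch, ps]
        exact ⟨and_comm, Or.inl (add_comm _ _)⟩

theorem inv_del (O B : ℂ) (rest : List ℂ) (hr : rest ≠ [])
    (h : convexHull ℝ {rest.getLastD B, B, rest.headD B} ⊆ ({O}ᶜ : Set ℂ)) :
    WInv O (B :: rest) rest := by
  cases rest with
  | nil => exact absurd rfl hr
  | cons C m =>
    rcases List.eq_nil_or_concat m with rfl | ⟨m', A, rfl⟩
    · simp only [List.headD_cons] at h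
      have h' : convexHull ℝ {C, B, C} ⊆ ({O}ᶜ : Set ℂ) := h
      rw [WInv, notThrough_cons, notThrough_cons, windingSum_cons, windingSum_cons]
      simp only [Ch, ps]
      have g1 := tri_good O _ h' (x := B) (y := C) (by simp) (by simp)
      have g2 := tri_good O _ h' (x := C) (y := B) (by simp) (by simp)
      have g3 := tri_good O _ h' (x := C) (y := C) (by simp) (by simp)
      refine ⟨by tauto, Or.inl ?_⟩
      rw [add_comm]; exact tri_ang O C B C h'
    · have h' : convexHull ℝ {A, B, C} ⊆ ({O}ᶜ : Set ℂ) := by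
        have e : (C :: (m' ++ [A])).getLastD B = A :=
          getLastD_aux _ _ _ _
        rw [List.concat_eq_append, e] at h
        exact h
      rw [List.concat_eq_append, WInv, notThrough_cons, notThrough_cons, windingSum_cons,
        windingSum_cons]
      simp only [Ch, ps, Ch_append, ps_append]
      have g1 := tri_good O _ h' (x := B) (y := C) (by simp) (by simp)
      have g2 := tri_good O _ h' (x := A) (y := B) (by simp) (by simp)
      have g3 := tri_good O _ h' (x := A) (y := C) (by simp) (by simp)
      refine ⟨by tauto, Or.inl ?_⟩
      rw [← tri_ang O A B C h']; ring

theorem inv_homotopic (O : ℂ) (l l' : List ℂ) (h : Homotopic ({O}ᶜ : Set ℂ) l l') :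
    WInv O l l' := by
  induction h with
  | refl => exact WInv.refl _ _
  | symm _ _ _ ih => exact ih.symm
  | trans _ _ _ _ _ ih1 ih2 => exact ih1.trans ih2
  | rel l l' h =>
    rcases h with ⟨n, rfl⟩ | ⟨B, rest, hr, ⟨n, hn⟩, ⟨k, hk⟩, hh⟩
    · exact inv_rotate _ _ _
    · have a1 := inv_rotate O l n
      have a2 := inv_rotate O l' k
      rw [← hn] at a1
      rw [← hk] at a2
      exact a1.trans ((inv_del O B rest hr hh).trans a2.symm)

/-! Lifted paths -/

def stp (a b : ℂ) : Prop := |a.im - b.im| < π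

def tri (a b c : ℂ) : Prop := stp a b ∧ stp b c ∧ stp a c

def mst (s : ℝ) (a b : ℂ) : Prop := stp a b ∧ s * a.im ≤ s * b.im

inductive PH : ℂ → ℂ → List ℂ → List ℂ → Prop
  | refl (a b : ℂ) (L : List ℂ) : PH a b L L
  | symm (a b : ℂ) (L M : List ℂ) : PH a b L M → PH a b M L
  | trans (a b : ℂ) (L M K : List ℂ) : PH a b L M → PH a b M K → PH a b L K
  | cons (a x b : ℂ) (L M : List ℂ) : PH x b L M → PH a b (x :: L) (x :: M)
  | delEnd (a x b : ℂ) : tri a x b → PH a b [x] []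
  | del (a x y b : ℂ) (L : List ℂ) : tri a x y → PH a b (x :: y :: L) (y :: L)

theorem stp_symm (a b : ℂ) (h : stp a b) : stp b a := by
  unfold stp at *; rwa [abs_sub_comm]

theorem mst_mid {s : ℝ} (hs : s = 1 ∨ s = -1) {a x y : ℂ} (h : stp a y)
    (h1 : s * a.im ≤ s * x.im) (h2 : s * x.im ≤ s * y.im) :
    tri a x y ∧ mst s a x ∧ mst s x y := by
  unfold tri mst stp at *
  rw [abs_lt] at *
  simp only [abs_lt]
  rcases hs with rfl | rfl <;> refine ⟨⟨⟨?_, ?_⟩, ⟨?_, ?_⟩, ?_, ?_⟩, ⟨⟨?_, ?_⟩, ?_⟩, ⟨?_, ?_⟩, ?_⟩ <;>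
    linarith

theorem mst_peak {s : ℝ} (hs : s = 1 ∨ s = -1) {a x y : ℂ} (h : stp a x)
    (h1 : s * x.im ≤ s * a.im) (h2 : mst s x y) : tri a x y := by
  unfold tri mst stp at *
  rw [abs_lt] at *
  simp only [abs_lt]
  obtain ⟨⟨h3, h4⟩, h5⟩ := h2
  rcases hs with rfl | rfl <;> refine ⟨⟨?_, ?_⟩, ⟨?_, ?_⟩, ?_, ?_⟩ <;> linarith

theorem Ch_le {s : ℝ} (a : ℂ) (L : List ℂ) (b : ℂ) (h : Ch (mst s) a L b) :
    s * a.im ≤ s * b.im := by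
  induction L generalizing a with
  | nil => exact h.2
  | cons x L ih => exact h.1.2.trans (ih _ h.2)

theorem Ch_neg {s : ℝ} (a : ℂ) (L : List ℂ) (b : ℂ) (h : Ch (mst s) a L b)
    (hab : s * b.im ≤ s * a.im) : Ch (mst (-s)) a L b := by
  induction L generalizing a with
  | nil => exact ⟨h.1, by linarith⟩
  | cons x L ih =>
    have := Ch_le _ _ _ h.2
    have := h.1.2
    exact ⟨⟨h.1.1, by linarith⟩, ih _ h.2 (by linarith)⟩

theorem mono_unique {s : ℝ} (hs : s = 1 ∨ s = -1) (b : ℂ) (n : ℕ) :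
    ∀ (a : ℂ) (L M : List ℂ), L.length + M.length ≤ n → Ch (mst s) a L b → Ch (mst s) a M b →
      PH a b L M := by
  induction n with
  | zero =>
    intro a L M h _ _
    have h1 : L = [] := List.length_eq_zero_iff.1 (by omega)
    have h2 : M = [] := List.length_eq_zero_iff.1 (by omega)
    subst h1 h2
    exact PH.refl _ _ _
  | succ n ih =>
    have nilcase : ∀ (a y : ℂ) (M : List ℂ), M.length ≤ n → Ch (mst s) a [] b →
        Ch (mst s) a (y :: M) b → PH a b [] (y :: M) := by
      intro a y M h hL hM
      obtain ⟨t, h1, h2⟩ := mst_mid hs hL.1 hM.1.2 (Ch_le _ _ _ hM.2)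
      exact PH.trans _ _ _ _ _ (PH.symm _ _ _ _ (PH.delEnd a y b t))
        (PH.cons _ _ _ _ _ (ih y [] M (by simpa using h) h2 hM.2))
    have conscase : ∀ (a x y : ℂ) (L M : List ℂ), L.length + (M.length + 1) ≤ n →
        s * x.im ≤ s * y.im → Ch (mst s) a (x :: L) b →
        Ch (mst s) a (y :: M) b → PH a b (x :: L) (y :: M) := by
      intro a x y L M h hxy hL hM
      obtain ⟨t, h1, h2⟩ := mst_mid hs hM.1.1 hL.1.2 hxy
      exact PH.trans _ _ _ _ _ (PH.cons _ _ _ _ _ (ih x L (y :: M) (by simpa using h) hL.2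
        ⟨h2, hM.2⟩)) (PH.del _ _ _ _ _ t)
    intro a L M h hL hM
    cases L with
    | nil =>
      cases M with
      | nil => exact PH.refl _ _ _
      | cons y M => exact nilcase a y M (by simpa using h) hL hM
    | cons x L =>
      cases M with
      | nil => exact PH.symm _ _ _ _ (nilcase a x L (by simpa using h) hM hL)
      | cons y M =>
        simp only [List.length_cons] at h
        rcases le_total (s * x.im) (s * y.im) with hxy | hxy
        · exact conscase a x y L M (by omega) hxy hL hM
        · exact PH.symm _ _ _ _ (conscase a y x M L (by omega) hxy hM hL)

theorem neg_sign {s : ℝ} (hs : s = 1 ∨ s = -1) : -s = 1 ∨ -s = -1 := by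
  rcases hs with rfl | rfl <;> simp

theorem mono_prepend {s : ℝ} (hs : s = 1 ∨ s = -1) (a b x : ℂ) (M : List ℂ) (hax : stp a x)
    (h : Ch (mst s) x M b) : ∃ s' : ℝ, (s' = 1 ∨ s' = -1) ∧ ∃ L, Ch (mst s') a L b ∧
      PH a b (x :: M) L := by
  induction M generalizing x with
  | nil =>
    rcases le_total (s * a.im) (s * x.im) with h1 | h1
    · exact ⟨s, hs, [x], ⟨⟨hax, h1⟩, h⟩, PH.refl _ _ _⟩
    · have t := mst_peak hs hax h1 h
      rcases le_total (s * a.im) (s * b.im) with h2 | h2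
      · exact ⟨s, hs, [], ⟨t.2.2, h2⟩, PH.delEnd _ _ _ t⟩
      · exact ⟨-s, neg_sign hs, [], ⟨t.2.2, by linarith⟩, PH.delEnd _ _ _ t⟩
  | cons y M ih =>
    rcases le_total (s * a.im) (s * x.im) with h1 | h1
    · exact ⟨s, hs, x :: y :: M, ⟨⟨hax, h1⟩, h⟩, PH.refl _ _ _⟩
    · have t := mst_peak hs hax h1 h.1
      obtain ⟨s', hs', L, hL, hP⟩ := ih y t.2.2 h.2
      exact ⟨s', hs', L, hL, PH.trans _ _ _ _ _ (PH.del _ _ _ _ _ t) hP⟩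

theorem exists_mono (a b : ℂ) (L : List ℂ) (h : Ch stp a L b) :
    ∃ s : ℝ, (s = 1 ∨ s = -1) ∧ ∃ M, Ch (mst s) a M b ∧ PH a b L M := by
  induction L generalizing a with
  | nil =>
    rcases le_total a.im b.im with h1 | h1
    · exact ⟨1, Or.inl rfl, [], ⟨h, by linarith⟩, PH.refl _ _ _⟩
    · exact ⟨-1, Or.inr rfl, [], ⟨h, by linarith⟩, PH.refl _ _ _⟩
  | cons x L ih =>
    obtain ⟨s, hs, M, hM, hP⟩ := ih x h.2
    obtain ⟨s', hs', M', hM', hP'⟩ := mono_prepend hs a b x M h.1 hM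
    exact ⟨s', hs', M', hM', PH.trans _ _ _ _ _ (PH.cons _ _ _ _ _ hP) hP'⟩

theorem path_unique (a b : ℂ) (L M : List ℂ) (hL : Ch stp a L b) (hM : Ch stp a M b) :
    PH a b L M := by
  obtain ⟨s, hs, L', hL', hP⟩ := exists_mono a b L hL
  obtain ⟨s', hs', M', hM', hP'⟩ := exists_mono a b M hM
  have key : PH a b L' M' := by
    by_cases hss : s' = s
    · subst hss
      exact mono_unique hs b _ a L' M' le_rfl hL' hM'
    · have e : s' = -s := by
        rcases hs with rfl | rfl <;> rcases hs' with rfl | rfl <;> simp_all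
      subst e
      have := Ch_le _ _ _ hM'
      exact mono_unique hs' b _ a L' M' le_rfl (Ch_neg _ _ _ hL' (by linarith)) hM'
  exact PH.trans _ _ _ _ _ hP (PH.trans _ _ _ _ _ key (PH.symm _ _ _ _ hP'))

theorem exists_path (n : ℕ) : ∀ a b : ℂ, |b.im - a.im| ≤ n → ∃ L, Ch stp a L b := by
  induction n with
  | zero =>
    intro a b h
    refine ⟨[], ?_⟩
    have := Real.pi_pos
    show |a.im - b.im| < π
    rw [abs_sub_comm]
    push_cast at h
    linarith
  | succ n ih =>
    intro a b h
    have hn : (0 : ℝ) < n + 1 := by positivity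
    push_cast at h
    set x : ℂ := ⟨a.re, a.im + (b.im - a.im) / (n + 1)⟩ with hx
    have h1 : |a.im - x.im| ≤ 1 := by
      have : a.im - x.im = -((b.im - a.im) / (n + 1)) := by simp [hx]
      rw [this, abs_neg, abs_div, abs_of_pos hn, div_le_one hn]
      exact h
    have h2 : |b.im - x.im| ≤ n := by
      have : b.im - x.im = (b.im - a.im) * (n / (n + 1)) := by
        simp only [hx]; field_simp; ring
      rw [this, abs_mul, abs_of_nonneg (a := (n : ℝ) / (n + 1)) (by positivity)]
      calc |b.im - a.im| * (n / (n + 1)) ≤ (n + 1) * (n / (n + 1)) := by gcongr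
        _ = n := by field_simp
    obtain ⟨L, hL⟩ := ih x b h2
    refine ⟨x :: L, ?_, hL⟩
    have := Real.pi_gt_three
    show |a.im - x.im| < π
    linarith

theorem exists_path' (a b : ℂ) : ∃ L, Ch stp a L b := by
  obtain ⟨n, hn⟩ := exists_nat_ge (|b.im - a.im|)
  exact exists_path n a b hn

noncomputable def fe (O w : ℂ) : ℂ := O + Complex.exp w

theorem tri_center {a b c : ℂ} (h : tri a b c) :
    ∃ m : ℝ, |a.im - m| < π / 2 ∧ |b.im - m| < π / 2 ∧ |c.im - m| < π / 2 := by
  unfold tri stp at h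
  simp only [abs_lt] at *
  obtain ⟨⟨h1, h2⟩, ⟨h3, h4⟩, h5, h6⟩ := h
  refine ⟨(max a.im (max b.im c.im) + min a.im (min b.im c.im)) / 2, ?_⟩
  rcases le_total a.im b.im with h | h <;> rcases le_total b.im c.im with h' | h' <;>
    rcases le_total a.im c.im with h'' | h'' <;>
    simp only [h, h', h'', max_eq_left, max_eq_right, min_eq_left, min_eq_right] <;>
    refine ⟨⟨?_, ?_⟩, ⟨?_, ?_⟩, ?_, ?_⟩ <;> linarith

theorem tri_hull (O : ℂ) {a b c : ℂ} (h : tri a b c) :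
    convexHull ℝ {fe O a, fe O b, fe O c} ⊆ ({O}ᶜ : Set ℂ) := by
  obtain ⟨m, ha, hb, hc⟩ := tri_center h
  set k : ℂ := Complex.exp (-(m * Complex.I)) with hk
  have lin : IsLinearMap ℝ (fun z : ℂ => (z * k).re) :=
    ⟨fun x y => by simp [add_mul], fun r x => by simp [mul_assoc]⟩
  have hpos : ∀ w : ℂ, |w.im - m| < π / 2 → (O * k).re < (fe O w * k).re := by
    intro w hw
    have : fe O w * k = O * k + Complex.exp (w - m * Complex.I) := by
      rw [fe, add_mul, hk, ← Complex.exp_add, sub_eq_add_neg]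
    rw [this, Complex.add_re, Complex.exp_re]
    have : 0 < Real.cos (w - m * Complex.I).im := by
      apply Real.cos_pos_of_mem_Ioo
      rw [abs_lt] at hw
      constructor <;> simp <;> linarith [hw.1, hw.2]
    have := mul_pos (Real.exp_pos (w - m * Complex.I).re) this
    linarith
  have sub : convexHull ℝ {fe O a, fe O b, fe O c} ⊆ {z : ℂ | (O * k).re < (z * k).re} := by
    apply convexHull_min _ (convex_halfSpace_gt lin _)
    rintro z (rfl | rfl | rfl)
    · exact hpos _ ha
    · exact hpos _ hb
    · exact hpos _ hc
  intro z hz hzO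
  have h1 := sub hz
  rw [Set.mem_singleton_iff.1 hzO] at h1
  exact lt_irrefl (O * k).re h1

theorem hom_rotate (N : Set ℂ) (l : List ℂ) (n : ℕ) : Homotopic N l (l.rotate n) :=
  Relation.EqvGen.rel _ _ (Or.inl ⟨n, rfl⟩)

theorem hom_swap (N : Set ℂ) (u v : List ℂ) : Homotopic N (u ++ v) (v ++ u) := by
  have := hom_rotate N (u ++ v) u.length
  rwa [List.rotate_append_length_eq] at this

theorem hom_del (N : Set ℂ) (u v : List ℂ) (a b c : ℂ) (h : convexHull ℝ {a, b, c} ⊆ N) :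
    Homotopic N (u ++ a :: b :: c :: v) (u ++ a :: c :: v) := by
  refine Relation.EqvGen.rel _ _ (Or.inr ⟨b, c :: v ++ (u ++ [a]), by simp, ⟨(u ++ [a]).length, ?_⟩,
    ⟨(u ++ [a]).length, ?_⟩, ?_⟩)
  · have := List.rotate_append_length_eq (u ++ [a]) (b :: c :: v)
    simp only [List.append_assoc, List.singleton_append, List.cons_append, List.nil_append] at this ⊢
    rw [this]
  · have := List.rotate_append_length_eq (u ++ [a]) (c :: v)
    simp only [List.append_assoc, List.singleton_append, List.cons_append, List.nil_append] at this ⊢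
    rw [this]
  · have e : (c :: v ++ (u ++ [a])).getLastD b = a := by
      rw [List.cons_append, ← List.append_assoc]
      exact getLastD_aux _ _ _ _
    rw [e]
    exact h

theorem PH_hom (O a b : ℂ) (L M : List ℂ) (h : PH a b L M) : ∀ u : List ℂ,
    Homotopic ({O}ᶜ : Set ℂ) ((u ++ a :: (L ++ [b])).map (fe O))
      ((u ++ a :: (M ++ [b])).map (fe O)) := by
  induction h with
  | refl => intro u; exact Relation.EqvGen.refl _
  | symm _ _ _ _ _ ih => intro u; exact Relation.EqvGen.symm _ _ (ih u)
  | trans _ _ _ _ _ _ _ ih1 ih2 => intro u; exact Relation.EqvGen.trans _ _ _ (ih1 u) (ih2 u)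
  | cons a x b L M _ ih =>
    intro u
    have := ih (u ++ [a])
    simpa using this
  | delEnd a x b t =>
    intro u
    have := hom_del _ (u.map (fe O)) [] _ _ _ (tri_hull O t)
    simpa using this
  | del a x y b L t =>
    intro u
    have := hom_del _ (u.map (fe O)) ((L ++ [b]).map (fe O)) _ _ _ (tri_hull O t)
    simpa using this

theorem path_hom (O a b : ℂ) (L M : List ℂ) (hL : Ch stp a L b) (hM : Ch stp a M b) :
    Homotopic ({O}ᶜ : Set ℂ) ((a :: (L ++ [b])).map (fe O))
      ((a :: (M ++ [b])).map (fe O)) :=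
  PH_hom O a b L M (path_unique a b L M hL hM) []

theorem good_ne {O a b : ℂ} (h : good O a b) : a ≠ O ∧ b ≠ O :=
  ⟨fun e => h (e ▸ left_mem_segment ℝ a b), fun e => h (e ▸ right_mem_segment ℝ a b)⟩

theorem good_ang {O a b : ℂ} (h : good O a b) : |ang O a b| < π := by
  obtain ⟨ha, hb⟩ := good_ne h
  unfold ang
  set q := (b - O) / (a - O) with hq
  refine lt_of_le_of_ne (Complex.abs_arg_le_pi q) ?_
  intro he
  have hpi := Real.pi_pos
  have h1 : q.arg = π := by
    rcases abs_choice q.arg with h2 | h2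
    · rw [← h2, he]
    · have := Complex.neg_pi_lt_arg q
      linarith
  rw [Complex.arg_eq_pi_iff] at h1
  have hq' : q = (q.re : ℂ) := by apply Complex.ext <;> simp [h1.2]
  have hb' : b - O = q.re * (a - O) := by
    rw [← hq', hq, div_mul_cancel₀ _ (sub_ne_zero.2 ha)]
  apply h
  set r := -q.re with hr
  have hr0 : 0 < r := by linarith [h1.1]
  have hr1 : (1 + r : ℂ) ≠ 0 := by
    have : (1 + r : ℝ) ≠ 0 := by positivity
    exact_mod_cast this
  refine ⟨r / (1 + r), 1 / (1 + r), by positivity, by positivity, by field_simp; ring, ?_⟩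
  have hb2 : b = O - r * (a - O) := by
    have : (q.re : ℂ) = -(r : ℂ) := by simp [hr]
    rw [this] at hb'
    linear_combination hb'
  rw [hb2]
  simp only [Complex.real_smul]
  push_cast
  field_simp
  ring

theorem exists_lift (O : ℂ) (t : List ℂ) : ∀ (A B w : ℂ), fe O w = A → Ch (good O) A t B →
    ∃ L w', L.map (fe O) = t ∧ fe O w' = B ∧ Ch stp w L w' ∧ w'.im = w.im + ps (ang O) A t B := by
  have base : ∀ (A B w : ℂ), fe O w = A → good O A B →
      ∃ w', fe O w' = B ∧ stp w w' ∧ w'.im = w.im + ang O A B := by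
    intro A B w hw h
    obtain ⟨ha, hb⟩ := good_ne h
    have e : (w + Complex.log ((B - O) / (A - O))).im = w.im + ang O A B := by
      simp [ang, Complex.log_im]
    refine ⟨w + Complex.log ((B - O) / (A - O)), ?_, ?_, e⟩
    · have hw' : Complex.exp w = A - O := by rw [← hw, fe]; ring
      have ha' := sub_ne_zero.2 ha
      rw [fe, Complex.exp_add, Complex.exp_log (div_ne_zero (sub_ne_zero.2 hb) ha'), hw',
        mul_div_cancel₀ _ ha']
      ring
    · unfold stp
      rw [e]
      have := good_ang h
      simpa using this
  induction t with
  | nil =>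
    intro A B w hw h
    obtain ⟨w', h1, h2, h3⟩ := base A B w hw h
    exact ⟨[], w', rfl, h1, h2, h3⟩
  | cons x t ih =>
    intro A B w hw h
    obtain ⟨w', h1, h2, h3⟩ := base A x w hw h.1
    obtain ⟨L, w'', h4, h5, h6, h7⟩ := ih x B w' h1 h.2
    exact ⟨w' :: L, w'', by simp [h1, h4], h5, ⟨h2, h6⟩, by rw [h7, h3, ps]; ring⟩

theorem hom_close (O A : ℂ) (t : List ℂ) (h : NotThrough O (A :: t)) :
    Homotopic ({O}ᶜ : Set ℂ) (A :: (t ++ [A])) (A :: t) := by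
  rw [notThrough_cons] at h
  have key : ∀ x, (A :: t).getLastD A = x → good O x A → 
      Homotopic ({O}ᶜ : Set ℂ) (A :: (t ++ [A])) (A :: t) := by
    intro x hx hg
    refine Relation.EqvGen.rel _ _ (Or.inr ⟨A, A :: t, by simp, ⟨(A :: t).length, ?_⟩, ⟨0, by simp⟩, ?_⟩)
    · have := List.rotate_append_length_eq (A :: t) [A]
      simpa using this.symm
    · rw [hx]
      have : ({x, A, (A :: t).headD A} : Set ℂ) = {x, A} := by simp
      rw [this, convexHull_pair]
      intro z hz hzO
      rw [Set.mem_singleton_iff.1 hzO] at hz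
      exact hg hz
  rcases List.eq_nil_or_concat t with rfl | ⟨m', B, rfl⟩
  · exact key A rfl h
  · rw [List.concat_eq_append, Ch_append] at h
    exact key B (by rw [List.concat_eq_append]; exact getLastD_aux _ _ _ _) h.2

theorem fe_re {O a b : ℂ} (h : fe O a = fe O b) : a.re = b.re := by
  have h' : Complex.exp a = Complex.exp b := add_left_cancel h
  have := congrArg norm h'
  rw [Complex.norm_exp, Complex.norm_exp] at this
  exact Real.exp_injective this

theorem fe_surj {O A : ℂ} (h : A ≠ O) : ∃ w, fe O w = A :=
  ⟨Complex.log (A - O), by rw [fe, Complex.exp_log (sub_ne_zero.2 h)]; ring⟩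

theorem Ch_ne {O A : ℂ} {t : List ℂ} {B : ℂ} (h : Ch (good O) A t B) : A ≠ O := by
  cases t with
  | nil => exact (good_ne h).1
  | cons x t => exact (good_ne h.1).1

theorem hom_of_eq (O : ℂ) (l₁ l₂ : List ℂ) (n1 : l₁ ≠ []) (n2 : l₂ ≠ []) (h1 : NotThrough O l₁)
    (h2 : NotThrough O l₂) (h : windingSum O l₁ = windingSum O l₂) :
    Homotopic ({O}ᶜ : Set ℂ) l₁ l₂ := by
  obtain ⟨A, t, rfl⟩ := List.exists_cons_of_ne_nil n1
  obtain ⟨B, r, rfl⟩ := List.exists_cons_of_ne_nil n2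
  have c1 := hom_close O A t h1
  have c2 := hom_close O B r h2
  rw [notThrough_cons] at h1 h2
  rw [windingSum_cons, windingSum_cons] at h
  obtain ⟨w, hw⟩ := fe_surj (Ch_ne h1)
  obtain ⟨u, hu⟩ := fe_surj (Ch_ne h2)
  obtain ⟨L, w', hL, hw', pL, iL⟩ := exists_lift O t A A w hw h1
  obtain ⟨M, u', hM, hu', pM, iM⟩ := exists_lift O r B B u hu h2
  have rw' := fe_re (hw'.trans hw.symm)
  have ru' := fe_re (hu'.trans hu.symm)
  obtain ⟨C, hC⟩ := exists_path' w u
  set d : ℂ := w' - w with hd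
  have hwd : w + d = w' := by simp [hd]
  have hud : u + d = u' := by
    apply Complex.ext <;> simp [hd] <;> linarith
  have expd : Complex.exp d = 1 := by
    have h' : Complex.exp w' = Complex.exp w := add_left_cancel (hw'.trans hw.symm)
    rw [hd, Complex.exp_sub, h', div_self (Complex.exp_ne_zero _)]
  have hfe : ∀ z, fe O (z + d) = fe O z := by
    intro z; rw [fe, fe, Complex.exp_add, expd, mul_one]
  set C' := C.map (· + d) with hC'
  have pC' : Ch stp w' C' u' := by
    have := Ch_map stp (· + d) (fun a b hab => by unfold stp at *; simpa using hab) w C u hC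
    simpa only [hwd, hud] using this
  have fC' : C'.map (fe O) = C.map (fe O) := by
    simp [hC', hfe]
  have pCr := Ch_reverse stp stp_symm _ _ _ pC'
  have rfl_stp : ∀ z, stp z z := fun z => by unfold stp; simpa using Real.pi_pos
  -- first path
  have e1 := path_hom O w w' L (C ++ u :: u :: (M ++ u' :: C'.reverse)) pL (by
    rw [Ch_append]
    refine ⟨hC, rfl_stp u, ?_⟩
    rw [Ch_append]
    exact ⟨pM, pCr⟩)
  have e2 := path_hom O u u' (M ++ u' :: (C'.reverse ++ w' :: w' :: C')) M (by
    rw [Ch_append]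
    refine ⟨pM, ?_⟩
    rw [Ch_append]
    exact ⟨pCr, rfl_stp w', pC'⟩) pM
  have e3 := hom_swap ({O}ᶜ : Set ℂ) (A :: (C.map (fe O) ++ [B]))
    (B :: (r ++ B :: ((C.map (fe O)).reverse ++ [A])))
  simp only [List.map_cons, List.map_append, List.map_reverse, fC', hL, hM, hw, hu, hw', hu',
    List.map_nil, List.append_assoc, List.cons_append, List.nil_append] at e1 e2 e3
  exact Relation.EqvGen.trans _ _ _ (Relation.EqvGen.symm _ _ c1)
    (Relation.EqvGen.trans _ _ _ e1 (Relation.EqvGen.trans _ _ _ e3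
      (Relation.EqvGen.trans _ _ _ e2 c2)))

theorem stp_good (O a b : ℂ) (h : stp a b) : good O (fe O a) (fe O b) := by
  have t : tri a b b := ⟨h, by unfold stp; simpa using Real.pi_pos, h⟩
  exact tri_good O _ (tri_hull O t) (by simp) (by simp)

theorem stp_ang (O a b : ℂ) (h : stp a b) : ang O (fe O a) (fe O b) = b.im - a.im := by
  unfold stp at h
  rw [abs_lt] at h
  have e : (fe O b - O) / (fe O a - O) = Complex.exp (b - a) := by
    rw [fe, fe, Complex.exp_sub]; simp
  rw [ang, e, ← Complex.log_im, Complex.log_exp]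
  · simp
  · simp; linarith
  · simp; linarith

theorem Ch_down (O : ℂ) (L : List ℂ) (a b : ℂ) (h : Ch stp a L b) :
    Ch (good O) (fe O a) (L.map (fe O)) (fe O b) ∧
      ps (ang O) (fe O a) (L.map (fe O)) (fe O b) = b.im - a.im := by
  induction L generalizing a with
  | nil => exact ⟨stp_good O _ _ h, stp_ang O _ _ h⟩
  | cons x L ih =>
    obtain ⟨h1, h2⟩ := ih x h.2
    refine ⟨⟨stp_good O _ _ h.1, h1⟩, ?_⟩
    rw [List.map_cons, ps, h2, stp_ang O _ _ h.1]
    ring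

/-- the winding number around `O` induces a bijection between homotopy
classes of closed polygonal lines in `ℝ² ∖ {O}` and `ℤ`: two lines are homotopic in
`ℝ² ∖ {O}` iff their winding numbers around `O` agree, and every integer is realized. -/
theorem winding_classifies_homotopy_classes (O : ℂ) :
    (∀ l₁ l₂ : List ℂ, l₁ ≠ [] → l₂ ≠ [] → NotThrough O l₁ → NotThrough O l₂ →
      (Homotopic ({O}ᶜ : Set ℂ) l₁ l₂ ↔ windingSum O l₁ = windingSum O l₂)) ∧
    (∀ n : ℤ, ∃ l : List ℂ, l ≠ [] ∧ NotThrough O l ∧ windingSum O l = 2 * π * n) := by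
  refine ⟨fun l₁ l₂ n1 n2 h1 h2 => ⟨fun h => ?_, hom_of_eq O l₁ l₂ n1 n2 h1 h2⟩, fun n => ?_⟩
  · rcases (inv_homotopic O _ _ h).2 with h | h
    · exact h
    · exact absurd h1 h
  · obtain ⟨L, hL⟩ := exists_path' 0 (n * (2 * π * Complex.I))
    obtain ⟨h1, h2⟩ := Ch_down O L _ _ hL
    have e : fe O (n * (2 * π * Complex.I)) = fe O 0 := by
      rw [fe, fe, Complex.exp_int_mul_two_pi_mul_I, Complex.exp_zero]
    rw [e] at h1 h2
    refine ⟨fe O 0 :: L.map (fe O), by simp, (notThrough_cons _ _ _).2 h1, ?_⟩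
    rw [windingSum_cons, h2]
    simp
    ring
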